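/- Assume there exists λ > 0 such that −λ/(h(1+λ)) ≤ Q(t) ≤ −λ·h·b(t+h)² for all t ≥ 0, and let α be a real number with 0 < α ≤ h/2. Set ξ := 1 + λα/h. Then every solution x with x = ψ on [−h,0] satisfies |x(t)| ≤ √( 2·V(0) / (1 − 1/ξ) ) · exp( (1/2) ∫_{0}^{t−α} Q(s) ds ) for all t ≥ α. -/

import Mathlib

theorem hasDerivAt_integral_window {f : ℝ → ℝ} (hf : Continuous f) (h t : ℝ) :
    HasDerivAt (fun t => ∫ s in (t - h)..t, f s) (f t - f (t - h)) t := by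
  have hd : ∀ r, HasDerivAt (fun r => ∫ s in (0 : ℝ)..r, f s) (f r) r := fun r =>
    hf.integral_hasStrictDerivAt 0 r |>.hasDerivAt
  have hshift := (hd (t - h)).comp t ((hasDerivAt_id t).sub_const h)
  rw [mul_one] at hshift
  refine ((hd t).sub hshift).congr_of_eventuallyEq (Filter.Eventually.of_forall fun r => ?_)
  exact (intervalIntegral.integral_interval_sub_left (hf.intervalIntegrable _ _)
    (hf.intervalIntegrable _ _)).symm

theorem integral_eq_primitive_sub {g : ℝ → ℝ} (hg : Continuous g) (s t : ℝ) :
    ∫ u in s..t, g u = (∫ u in (0 : ℝ)..t, g u) - ∫ u in (0 : ℝ)..s, g u :=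
  (intervalIntegral.integral_interval_sub_left (hg.intervalIntegrable _ _)
    (hg.intervalIntegrable _ _)).symm

theorem continuous_integral_lower {g : ℝ → ℝ} (hg : Continuous g) (t : ℝ) :
    Continuous fun s => ∫ u in s..t, g u := by
  rw [funext fun s => integral_eq_primitive_sub hg s t]
  exact continuous_const.sub
    (intervalIntegral.continuous_primitive (fun _ _ => hg.intervalIntegrable _ _) 0)

theorem hasDerivAt_double_integral_window {g : ℝ → ℝ} (hg : Continuous g) (h t : ℝ) :
    HasDerivAt (fun t => ∫ s in (t - h)..t, ∫ u in s..t, g u)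
      (h * g t - ∫ u in (t - h)..t, g u) t := by
  set G : ℝ → ℝ := fun r => ∫ u in (0 : ℝ)..r, g u with hG
  have hGc : Continuous G :=
    intervalIntegral.continuous_primitive (fun _ _ => hg.intervalIntegrable _ _) 0
  have hGd : HasDerivAt G (g t) t := hg.integral_hasStrictDerivAt 0 t |>.hasDerivAt
  have hd := (hGd.const_mul h).sub (hasDerivAt_integral_window hGc h t)
  rw [← integral_eq_primitive_sub hg] at hd
  refine hd.congr_of_eventuallyEq (Filter.Eventually.of_forall fun r => ?_)
  dsimp only
  rw [funext fun s => integral_eq_primitive_sub hg s r, intervalIntegral.integral_sub (continuous_const.intervalIntegrable _ _)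
    (hGc.intervalIntegrable _ _)]
  simp [hG]

theorem integral_mono_interval_of_nonneg {g : ℝ → ℝ} (hg : Continuous g) (hg0 : ∀ u, 0 ≤ g u)
    {a b c d : ℝ} (hca : c ≤ a) (hab : a ≤ b) (hbd : b ≤ d) :
    ∫ u in a..b, g u ≤ ∫ u in c..d, g u :=
  intervalIntegral.integral_mono_interval hca hab hbd
    (Filter.Eventually.of_forall hg0) (hg.intervalIntegrable _ _)

theorem double_integral_window_le {g : ℝ → ℝ} (hg : Continuous g) (hg0 : ∀ u, 0 ≤ g u)
    {h : ℝ} (hh : 0 ≤ h) (t : ℝ) :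
    ∫ s in (t - h)..t, ∫ u in s..t, g u ≤ h * ∫ u in (t - h)..t, g u := by
  calc ∫ s in (t - h)..t, ∫ u in s..t, g u
      ≤ ∫ _s in (t - h)..t, ∫ u in (t - h)..t, g u := by
        refine intervalIntegral.integral_mono_on (by linarith)
          ((continuous_integral_lower hg t).intervalIntegrable _ _)
          (continuous_const.intervalIntegrable _ _) fun s hs => ?_
        exact integral_mono_interval_of_nonneg hg hg0 hs.1 hs.2 le_rfl
    _ = h * ∫ u in (t - h)..t, g u := by simp

theorem mul_integral_le_double_integral {g : ℝ → ℝ} (hg : Continuous g) (hg0 : ∀ u, 0 ≤ g u)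
    {r m t : ℝ} (hrm : r ≤ m) (hmt : m ≤ t) :
    (m - r) * ∫ u in m..t, g u ≤ ∫ s in r..t, ∫ u in s..t, g u := by
  have hc := continuous_integral_lower hg t
  have hi := fun p q => hc.intervalIntegrable (μ := MeasureTheory.volume) p q
  rw [← intervalIntegral.integral_add_adjacent_intervals (hi r m) (hi m t)]
  have h1 : (m - r) * ∫ u in m..t, g u ≤ ∫ s in r..m, ∫ u in s..t, g u := by
    calc (m - r) * ∫ u in m..t, g u = ∫ _s in r..m, ∫ u in m..t, g u := by simp
      _ ≤ _ := intervalIntegral.integral_mono_on hrm (continuous_const.intervalIntegrable _ _)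
          (hi r m) fun s hs => integral_mono_interval_of_nonneg hg hg0 hs.2 hmt le_rfl
  have h2 : 0 ≤ ∫ s in m..t, ∫ u in s..t, g u :=
    intervalIntegral.integral_nonneg hmt fun s hs =>
      intervalIntegral.integral_nonneg hs.2 fun u _ => hg0 u
  linarith

theorem mul_integral_window_le_double_integral_add {g : ℝ → ℝ} (hg : Continuous g)
    (hg0 : ∀ u, 0 ≤ g u) {h α : ℝ} (hα : 0 ≤ α) (hαh : α ≤ h / 2) (t : ℝ) :
    α * ∫ u in (t - h)..t, g u ≤
      (∫ s in (t - h)..t, ∫ u in s..t, g u) +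
        ∫ s in (t - α - h)..(t - α), ∫ u in s..(t - α), g u := by
  have h1 := mul_integral_le_double_integral hg hg0
    (show t - h ≤ t - α by linarith) (show t - α ≤ t by linarith)
  have h2 := mul_integral_le_double_integral hg hg0
    (show t - α - h ≤ t - h by linarith) (show t - h ≤ t - α by linarith)
  have h3 : 0 ≤ ∫ u in (t - α)..t, g u :=
    intervalIntegral.integral_nonneg (by linarith) fun u _ => hg0 u
  rw [← intervalIntegral.integral_add_adjacent_intervals
    (hg.intervalIntegrable (t - h) (t - α)) (hg.intervalIntegrable (t - α) t)]
  nlinarith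

theorem sq_integral_le {f : ℝ → ℝ} (hf : Continuous f) {a b : ℝ} (hab : a < b) :
    (∫ u in a..b, f u) ^ 2 ≤ (b - a) * ∫ u in a..b, f u ^ 2 := by
  set I := ∫ u in a..b, f u with hI
  have h0 : 0 ≤ ∫ u in a..b, ((b - a) * f u - I) ^ 2 :=
    intervalIntegral.integral_nonneg hab.le fun u _ => sq_nonneg _
  have h1 : ∫ u in a..b, ((b - a) * f u - I) ^ 2 =
      (b - a) * ((b - a) * (∫ u in a..b, f u ^ 2) - I ^ 2) := by
    have he : ∀ u, ((b - a) * f u - I) ^ 2 =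
        (b - a) ^ 2 * f u ^ 2 - 2 * (b - a) * I * f u + I ^ 2 := fun u => by ring
    simp_rw [he]
    rw [intervalIntegral.integral_add (Continuous.intervalIntegrable (by fun_prop) _ _)
        (Continuous.intervalIntegrable (by fun_prop) _ _),
      intervalIntegral.integral_sub (Continuous.intervalIntegrable (by fun_prop) _ _)
        (Continuous.intervalIntegrable (by fun_prop) _ _),
      intervalIntegral.integral_const_mul, intervalIntegral.integral_const_mul,
      intervalIntegral.integral_const, ← hI, smul_eq_mul]
    ring
  rw [h1] at h0
  exact sub_nonneg.mp (nonneg_of_mul_nonneg_right h0 (sub_pos.mpr hab))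

/-- Grönwall's inequality in exponential form for a scalar differential inequality. -/
theorem le_mul_exp_integral_of_deriv_le {V V' q : ℝ → ℝ} (hq : Continuous q)
    (hVc : ContinuousOn V (Set.Ici 0)) (hV : ∀ t, 0 < t → HasDerivAt V (V' t) t)
    (hle : ∀ t, 0 < t → V' t ≤ q t * V t) {s t : ℝ} (hs : 0 ≤ s) (hst : s ≤ t) :
    V t ≤ V s * Real.exp (∫ u in s..t, q u) := by
  set P : ℝ → ℝ := fun t => ∫ u in (0 : ℝ)..t, q u with hP
  have hPd : ∀ t, HasDerivAt P (q t) t := fun t =>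
    hq.integral_hasStrictDerivAt 0 t |>.hasDerivAt
  have hPc : Continuous P := continuous_iff_continuousAt.mpr fun t => (hPd t).continuousAt
  have hanti : AntitoneOn (fun t => V t * Real.exp (-P t)) (Set.Ici 0) := by
    have hder : ∀ t, 0 < t → HasDerivAt (fun t => V t * Real.exp (-P t))
        (V' t * Real.exp (-P t) + V t * (Real.exp (-P t) * -q t)) t := fun t ht =>
      (hV t ht).mul (hPd t).neg.exp
    refine antitoneOn_of_deriv_nonpos (convex_Ici 0)
      (hVc.mul (by fun_prop)) ?_ ?_
    · rw [interior_Ici]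
      exact fun t ht => (hder t ht).differentiableAt.differentiableWithinAt
    · rw [interior_Ici]
      intro t ht
      rw [(hder t ht).deriv]
      nlinarith [hle t ht, Real.exp_pos (-P t)]
  have hst' := hanti (Set.mem_Ici.mpr hs) (Set.mem_Ici.mpr (hs.trans hst)) hst
  dsimp only at hst'
  rw [integral_eq_primitive_sub hq s t, sub_eq_neg_add, Real.exp_add, ← mul_assoc]
  calc V t = V t * Real.exp (-P t) * Real.exp (P t) := by
        rw [mul_assoc, ← Real.exp_add, neg_add_cancel, Real.exp_zero, mul_one]
    _ ≤ _ := mul_le_mul_of_nonneg_right hst' (Real.exp_pos _).le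

theorem one_sub_inv_mul_sq_le {ξ : ℝ} (hξ : 0 < ξ) (x y : ℝ) :
    (1 - 1 / ξ) * x ^ 2 ≤ (x + y) ^ 2 + (ξ - 1) * y ^ 2 := by
  have he : (x + y) ^ 2 + (ξ - 1) * y ^ 2 - (1 - 1 / ξ) * x ^ 2 = (x + ξ * y) ^ 2 / ξ := by
    field_simp
    ring
  linarith [show 0 ≤ (x + ξ * y) ^ 2 / ξ by positivity]

theorem stmt12 (h lam α : ℝ) (hh : 0 < h) (hlam : 0 < lam)
    (hα : 0 < α) (hαh : α ≤ h / 2)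
    (a b x ψ : ℝ → ℝ) (ha : Continuous a) (hb : Continuous b)
    -- x is a solution of the delay differential equation with initial function ψ
    (hxc : ContinuousOn x (Set.Ici (-h)))
    (hx : ∀ t, (0 : ℝ) ≤ t → HasDerivWithinAt x (a t * x t + b t * x (t - h)) (Set.Ici 0) t)
    (hψ : ContinuousOn ψ (Set.Icc (-h) 0))
    (hinit : ∀ t ∈ Set.Icc (-h) (0 : ℝ), x t = ψ t)
    -- the auxiliary functions Q, A, V
    (Q A V : ℝ → ℝ)
    (hQ : ∀ t, Q t = a t + b (t + h))
    (hA : ∀ t, A t = x t + ∫ s in (t - h)..t, b (s + h) * x s)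
    (hV : ∀ t, V t = (A t) ^ 2 +
        lam * ∫ s in (t - h)..t, (∫ u in s..t, (b (u + h)) ^ 2 * (x u) ^ 2))
    -- the condition −λ/(h(1+λ)) ≤ Q(t) ≤ −λ·h·b(t+h)²
    (hcond : ∀ t, (0 : ℝ) ≤ t →
        -lam / (h * (1 + lam)) ≤ Q t ∧ Q t ≤ -lam * h * (b (t + h)) ^ 2) :
    ∀ t, α ≤ t →
      |x t| ≤ Real.sqrt (2 * V 0 / (1 - 1 / (1 + lam * α / h))) *
        Real.exp ((1 / 2) * ∫ s in (0 : ℝ)..(t - α), Q s) := by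
  have hbh : Continuous fun u => b (u + h) := by fun_prop
  have hQc : Continuous Q := by
    rw [show Q = fun t => a t + b (t + h) from funext hQ]
    fun_prop
  -- extend `x` continuously to the left of `-h`
  set y : ℝ → ℝ := fun t => x (max t (-h)) with hy
  have hyc : Continuous y :=
    hxc.comp_continuous (by fun_prop) fun t => Set.mem_Ici.mpr (le_max_right _ _)
  have hyx : ∀ t, -h ≤ t → y t = x t := fun t ht => by simp [hy, max_eq_left ht]
  set f : ℝ → ℝ := fun u => b (u + h) * y u with hf
  have hfc : Continuous f := hbh.mul hyc
  have hgc : Continuous fun u => f u ^ 2 := by fun_prop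
  have hg0 : ∀ u, 0 ≤ f u ^ 2 := fun u => sq_nonneg _
  set I : ℝ → ℝ := fun t => ∫ s in (t - h)..t, f s with hI
  set J : ℝ → ℝ := fun t => ∫ s in (t - h)..t, f s ^ 2 with hJ
  set W : ℝ → ℝ := fun t => ∫ s in (t - h)..t, ∫ u in s..t, f u ^ 2 with hW
  have hA' : ∀ t, 0 ≤ t → A t = y t + I t := by
    intro t ht
    rw [hA, hyx t (by linarith)]
    congr 1
    refine intervalIntegral.integral_congr fun s hs => ?_
    rw [Set.uIcc_of_le (by linarith)] at hs
    simp only [hf]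
    rw [hyx s (by linarith [hs.1])]
  have hV' : ∀ t, 0 ≤ t → V t = (y t + I t) ^ 2 + lam * W t := by
    intro t ht
    rw [hV, hA' t ht]
    congr 2
    refine intervalIntegral.integral_congr fun s hs => ?_
    rw [Set.uIcc_of_le (by linarith)] at hs
    refine intervalIntegral.integral_congr fun u hu => ?_
    rw [Set.uIcc_of_le hs.2] at hu
    simp only [hf]
    rw [hyx u (by linarith [hs.1, hu.1]), mul_pow]
  have hId : ∀ t, HasDerivAt I (f t - f (t - h)) t := hasDerivAt_integral_window hfc h
  have hWd : ∀ t, HasDerivAt W (h * f t ^ 2 - J t) t := hasDerivAt_double_integral_window hgc h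
  have hIc : Continuous I := continuous_iff_continuousAt.mpr fun t => (hId t).continuousAt
  have hWc : Continuous W := continuous_iff_continuousAt.mpr fun t => (hWd t).continuousAt
  have hIJ : ∀ t, I t ^ 2 ≤ h * J t := fun t => by
    simpa using sq_integral_le hfc (show t - h < t by linarith)
  have hWJ : ∀ t, W t ≤ h * J t := double_integral_window_le hgc hg0 hh.le
  have hJ0 : ∀ t, 0 ≤ J t := fun t =>
    intervalIntegral.integral_nonneg (by linarith) fun u _ => hg0 u
  have hW0 : ∀ t, 0 ≤ W t := fun t =>
    intervalIntegral.integral_nonneg (by linarith) fun s hs =>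
      intervalIntegral.integral_nonneg hs.2 fun u _ => hg0 u
  have hVc : ContinuousOn V (Set.Ici 0) :=
    ContinuousOn.congr (f := fun t => (y t + I t) ^ 2 + lam * W t) (by fun_prop)
      fun t ht => hV' t ht
  have hQ0 : ∀ t, 0 ≤ t → Q t ≤ 0 := fun t ht =>
    (hcond t ht).2.trans (by nlinarith [mul_nonneg (mul_pos hlam hh).le (sq_nonneg (b (t + h)))])
  have hVd : ∀ t, 0 < t → HasDerivAt V
      (2 * (y t + I t) * (Q t * y t) + lam * (h * f t ^ 2 - J t)) t := by
    intro t ht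
    have hyd : HasDerivAt y (a t * x t + b t * x (t - h)) t := by
      refine ((hx t ht.le).hasDerivAt (Ici_mem_nhds ht)).congr_of_eventuallyEq ?_
      filter_upwards [Ioi_mem_nhds ht] with s hs
      exact hyx s (by linarith [Set.mem_Ioi.mp hs])
    have hAd : HasDerivAt (fun t => y t + I t) (Q t * y t) t := by
      refine (hyd.add (hId t)).congr_deriv ?_
      simp only [hf, sub_add_cancel]
      rw [hyx t (by linarith), hyx (t - h) (by linarith), hQ]
      ring
    refine (((hAd.fun_pow 2).add ((hWd t).const_mul lam)).congr_of_eventuallyEq ?_).congr_deriv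
      (by ring)
    filter_upwards [Ioi_mem_nhds ht] with s hs
    exact hV' s (Set.mem_Ioi.mp hs).le
  have hVle : ∀ t, 0 < t →
      2 * (y t + I t) * (Q t * y t) + lam * (h * f t ^ 2 - J t) ≤ Q t * V t := by
    intro t ht
    rw [hV' t ht.le]
    obtain ⟨hlo, hhi⟩ := hcond t ht.le
    rw [div_le_iff₀ (by positivity)] at hlo
    have h1 : Q t * y t ^ 2 + lam * h * f t ^ 2 ≤ 0 := by
      simp only [hf]
      nlinarith [mul_le_mul_of_nonneg_right hhi (sq_nonneg (y t))]
    have h2 := mul_le_mul_of_nonpos_left (hIJ t) (hQ0 t ht.le)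
    have h3 := mul_le_mul_of_nonneg_left
      (mul_le_mul_of_nonpos_left (hWJ t) (hQ0 t ht.le)) hlam.le
    have h4 := mul_le_mul_of_nonneg_right hlo (hJ0 t)
    linarith
  intro t ht
  set ξ := 1 + lam * α / h with hξ
  have hξ1 : 1 < ξ := by
    have : 0 < lam * α / h := by positivity
    linarith
  have hc : 0 < 1 - 1 / ξ := by
    rw [sub_pos, div_lt_one (by linarith)]
    exact hξ1
  have htα : 0 ≤ t - α := by linarith
  have hV0 : ∀ t, 0 ≤ t → 0 ≤ V t := fun t ht => by
    rw [hV' t ht]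
    have := hW0 t
    positivity
  have hdecay := le_mul_exp_integral_of_deriv_le hQc hVc hVd hVle le_rfl htα
  have hmono : V t ≤ V (t - α) := by
    refine (le_mul_exp_integral_of_deriv_le hQc hVc hVd hVle htα
      (show t - α ≤ t by linarith)).trans (mul_le_of_le_one_right (hV0 _ htα) ?_)
    rw [Real.exp_le_one_iff]
    have hneg : 0 ≤ ∫ u in (t - α)..t, -Q u :=
      intervalIntegral.integral_nonneg (by linarith) fun u hu =>
        neg_nonneg.mpr (hQ0 u (htα.trans hu.1))
    rwa [intervalIntegral.integral_neg, neg_nonneg] at hneg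
  have hlower : (1 - 1 / ξ) * x t ^ 2 ≤ V t + V (t - α) := by
    rw [hV' t (by linarith), hV' _ htα, ← hyx t (by linarith)]
    have h1 := one_sub_inv_mul_sq_le (show 0 < ξ by linarith) (y t) (I t)
    have h2 : α * J t ≤ W t + W (t - α) :=
      mul_integral_window_le_double_integral_add hgc hg0 hα.le hαh t
    have h3 : (ξ - 1) * I t ^ 2 ≤ lam * (α * J t) := by
      calc (ξ - 1) * I t ^ 2 ≤ (ξ - 1) * (h * J t) :=
            mul_le_mul_of_nonneg_left (hIJ t) (by linarith)
        _ = lam * (α * J t) := by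
            rw [hξ]
            field_simp
            ring
    have h4 := mul_le_mul_of_nonneg_left h2 hlam.le
    linarith [sq_nonneg (y (t - α) + I (t - α))]
  have hsq : x t ^ 2 ≤ 2 * V 0 / (1 - 1 / ξ) * Real.exp (∫ s in (0 : ℝ)..(t - α), Q s) := by
    rw [div_mul_eq_mul_div, le_div_iff₀ hc]
    linarith
  calc |x t| = Real.sqrt (x t ^ 2) := (Real.sqrt_sq_eq_abs _).symm
    _ ≤ Real.sqrt (2 * V 0 / (1 - 1 / ξ) * Real.exp (∫ s in (0 : ℝ)..(t - α), Q s)) :=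
        Real.sqrt_le_sqrt hsq
    _ = _ := by
        rw [Real.sqrt_mul (div_nonneg (mul_nonneg zero_le_two (hV0 0 le_rfl)) hc.le),
          ← Real.exp_half, one_div_mul_eq_div]
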